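/- Let m and k be positive integers. Let μ'_1 > μ'_2 > ... > μ'_m ≥ 0 and μ̃_1 > μ̃_2 > ... > μ̃_k ≥ 0 be real numbers, and set μ'_{m+1} = 0 and μ̃_{k+1} = 0. Let 0 < r'_1 < r'_2 < ... < r'_m and 0 < r̃_1 < r̃_2 < ... < r̃_k be real numbers. Assume that for every j ∈ {1,...,k} there exists i ∈ {1,...,m} such that r'_i ≥ r̃_j and μ'_i ≥ μ̃_j. Then ∑_{j=1}^{k} r̃_j (μ̃_j − μ̃_{j+1}) ≤ ∑_{i=1}^{m} r'_i (μ'_i − μ'_{i+1}). -/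

import Mathlib

theorem sum_Icc_sub_succ (f : ℕ → ℝ) {a n : ℕ} (h : a ≤ n) :
    ∑ i ∈ Finset.Icc a n, (f i - f (i + 1)) = f a - f (n + 1) := by
  induction n, h using Nat.le_induction with
  | base => simp
  | succ n hn ih =>
    rw [Finset.sum_Icc_succ_top (by omega), ih]
    ring

theorem min_sub_min_le_min_sub_min {a b s t : ℝ} (hab : b ≤ a) (hst : s ≤ t) :
    min a s - min b s ≤ min a t - min b t := by
  grind

theorem min_sub_min_le_sub {a b : ℝ} (hab : b ≤ a) (t : ℝ) :
    min a t - min b t ≤ a - b := by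
  grind

theorem le_of_lt_succ_on_Icc {m : ℕ} {f : ℕ → ℝ}
    (hf : ∀ i, 1 ≤ i → i < m → f i < f (i + 1)) {a b : ℕ} (ha : 1 ≤ a) (hab : a ≤ b)
    (hb : b ≤ m) : f a ≤ f b := by
  induction b, hab using Nat.le_induction with
  | base => exact le_rfl
  | succ n hn ih => exact (ih (by omega)).trans (hf n (by omega) (by omega)).le

/-- The area of the part of the staircase with corners `(r i, μ i)` lying below height `t`. -/
noncomputable def staircaseAreaBelow (m : ℕ) (r μ : ℕ → ℝ) (t : ℝ) : ℝ :=
  ∑ i ∈ Finset.Icc 1 m, r i * (min (μ i) t - min (μ (i + 1)) t)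

/-- A horizontal strip between heights `s ≤ t` lying under the step with corner `(r i, μ i)`
contains a rectangle of width `r i`. -/
theorem mul_sub_le_staircaseAreaBelow_sub {m : ℕ} {r μ : ℕ → ℝ}
    (hμ : ∀ i, 1 ≤ i → i ≤ m → μ (i + 1) ≤ μ i) (hlast : μ (m + 1) = 0)
    (hpos : 0 < r 1) (hr : ∀ i, 1 ≤ i → i < m → r i < r (i + 1))
    {s t : ℝ} (hs : 0 ≤ s) (hst : s ≤ t) {i : ℕ} (hi : 1 ≤ i) (him : i ≤ m) (ht : t ≤ μ i) :
    r i * (t - s) ≤ staircaseAreaBelow m r μ t - staircaseAreaBelow m r μ s := by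
  let g : ℕ → ℝ := fun l => min (μ l) t - min (μ l) s
  have hg : ∀ l, 1 ≤ l → l ≤ m → 0 ≤ g l - g (l + 1) := fun l h1 hl => by
    have := min_sub_min_le_min_sub_min (hμ l h1 hl) hst
    simp only [g]
    linarith
  calc r i * (t - s) = r i * (g i - g (m + 1)) := by
        simp only [g, hlast]
        rw [min_eq_right ht, min_eq_right (hst.trans ht), min_eq_left hs,
          min_eq_left (hs.trans hst)]
        ring
    _ = ∑ l ∈ Finset.Icc i m, r i * (g l - g (l + 1)) := by
        rw [← Finset.mul_sum, sum_Icc_sub_succ g him]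
    _ ≤ ∑ l ∈ Finset.Icc i m, r l * (g l - g (l + 1)) := by
        refine Finset.sum_le_sum fun l hl => ?_
        obtain ⟨h1, h2⟩ := Finset.mem_Icc.mp hl
        exact mul_le_mul_of_nonneg_right (le_of_lt_succ_on_Icc hr hi h1 h2)
          (hg l (hi.trans h1) h2)
    _ ≤ ∑ l ∈ Finset.Icc 1 m, r l * (g l - g (l + 1)) := by
        refine Finset.sum_le_sum_of_subset_of_nonneg (Finset.Icc_subset_Icc_left hi)
          fun l hl _ => ?_
        obtain ⟨h1, h2⟩ := Finset.mem_Icc.mp hl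
        exact mul_nonneg (hpos.le.trans (le_of_lt_succ_on_Icc hr le_rfl h1 h2)) (hg l h1 h2)
    _ = staircaseAreaBelow m r μ t - staircaseAreaBelow m r μ s := by
        rw [staircaseAreaBelow, staircaseAreaBelow, ← Finset.sum_sub_distrib]
        exact Finset.sum_congr rfl fun l _ => by simp only [g]; ring

theorem staircaseAreaBelow_le {m : ℕ} {r μ : ℕ → ℝ}
    (hμ : ∀ i, 1 ≤ i → i ≤ m → μ (i + 1) ≤ μ i)
    (hpos : 0 < r 1) (hr : ∀ i, 1 ≤ i → i < m → r i < r (i + 1)) (t : ℝ) :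
    staircaseAreaBelow m r μ t ≤ ∑ i ∈ Finset.Icc 1 m, r i * (μ i - μ (i + 1)) := by
  refine Finset.sum_le_sum fun i hi => ?_
  obtain ⟨h1, h2⟩ := Finset.mem_Icc.mp hi
  exact mul_le_mul_of_nonneg_left (min_sub_min_le_sub (hμ i h1 h2) t)
    (hpos.le.trans (le_of_lt_succ_on_Icc hr le_rfl h1 h2))

theorem succ_le_of_succ_lt {m : ℕ} {μ : ℕ → ℝ}
    (hdec : ∀ i, 1 ≤ i → i < m → μ (i + 1) < μ i) (hm : 0 ≤ μ m) (hlast : μ (m + 1) = 0)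
    (i : ℕ) (hi : 1 ≤ i) (him : i ≤ m) : μ (i + 1) ≤ μ i := by
  rcases him.lt_or_eq with h | rfl
  · exact (hdec i hi h).le
  · rwa [hlast]

theorem nonneg_of_succ_le {m : ℕ} {μ : ℕ → ℝ}
    (hμ : ∀ i, 1 ≤ i → i ≤ m → μ (i + 1) ≤ μ i) (hlast : μ (m + 1) = 0)
    (i : ℕ) (hi : 1 ≤ i) (him : i ≤ m + 1) : 0 ≤ μ i := by
  induction him using Nat.decreasingInduction with
  | self => exact hlast.ge
  | of_succ n hn ih => exact (ih (by omega)).trans (hμ n hi (by omega))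

theorem staircaseAreaBelow_zero {m : ℕ} {r μ : ℕ → ℝ}
    (hμ : ∀ i, 1 ≤ i → i ≤ m + 1 → 0 ≤ μ i) : staircaseAreaBelow m r μ 0 = 0 := by
  refine Finset.sum_eq_zero fun i hi => ?_
  obtain ⟨h1, h2⟩ := Finset.mem_Icc.mp hi
  rw [min_eq_right (hμ i h1 (by omega)), min_eq_right (hμ (i + 1) (by omega) (by omega)),
    sub_zero, mul_zero]

/-- Numerical core of Proposition 2.5: if every point `(r̃ j, μ̃ j)` of the second
staircase lies under the first staircase, then the second staircase area is at most
the first one. -/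
theorem staircase_area_le
    (m k : ℕ) (hm : 0 < m) (hk : 0 < k)
    (μ' μt r' rt : ℕ → ℝ)
    -- μ'_1 > μ'_2 > ... > μ'_m ≥ 0, μ'_{m+1} = 0
    (hμ'dec : ∀ i, 1 ≤ i → i < m → μ' (i + 1) < μ' i)
    (hμ'nonneg : 0 ≤ μ' m)
    (hμ'last : μ' (m + 1) = 0)
    -- μ̃_1 > μ̃_2 > ... > μ̃_k ≥ 0, μ̃_{k+1} = 0
    (hμtdec : ∀ j, 1 ≤ j → j < k → μt (j + 1) < μt j)
    (hμtnonneg : 0 ≤ μt k)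
    (hμtlast : μt (k + 1) = 0)
    -- 0 < r'_1 < r'_2 < ... < r'_m
    (hr'pos : 0 < r' 1)
    (hr'inc : ∀ i, 1 ≤ i → i < m → r' i < r' (i + 1))
    -- 0 < r̃_1 < r̃_2 < ... < r̃_k
    (hrtpos : 0 < rt 1)
    (hrtinc : ∀ j, 1 ≤ j → j < k → rt j < rt (j + 1))
    -- domination hypothesis
    (hdom : ∀ j, 1 ≤ j → j ≤ k → ∃ i, 1 ≤ i ∧ i ≤ m ∧ rt j ≤ r' i ∧ μt j ≤ μ' i) :
    ∑ j ∈ Finset.Icc 1 k, rt j * (μt j - μt (j + 1)) ≤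
      ∑ i ∈ Finset.Icc 1 m, r' i * (μ' i - μ' (i + 1)) := by
  have hμ' := succ_le_of_succ_lt hμ'dec hμ'nonneg hμ'last
  have hμt := succ_le_of_succ_lt hμtdec hμtnonneg hμtlast
  have hμt0 := nonneg_of_succ_le hμt hμtlast
  let F := staircaseAreaBelow m r' μ'
  calc ∑ j ∈ Finset.Icc 1 k, rt j * (μt j - μt (j + 1))
      ≤ ∑ j ∈ Finset.Icc 1 k, (F (μt j) - F (μt (j + 1))) := by
        refine Finset.sum_le_sum fun j hj => ?_
        obtain ⟨h1, h2⟩ := Finset.mem_Icc.mp hj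
        obtain ⟨i, hi, him, hrt, hle⟩ := hdom j h1 h2
        exact (mul_le_mul_of_nonneg_right hrt (sub_nonneg.mpr (hμt j h1 h2))).trans
          (mul_sub_le_staircaseAreaBelow_sub hμ' hμ'last hr'pos hr'inc
            (hμt0 (j + 1) (by omega) (by omega)) (hμt j h1 h2) hi him hle)
    _ = F (μt 1) := by
        rw [sum_Icc_sub_succ (fun j => F (μt j)) hk, hμtlast]
        simp only [F, staircaseAreaBelow_zero (nonneg_of_succ_le hμ' hμ'last), sub_zero]
    _ ≤ ∑ i ∈ Finset.Icc 1 m, r' i * (μ' i - μ' (i + 1)) :=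
        staircaseAreaBelow_le hμ' hr'pos hr'inc _
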